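/- arXiv:2511.22126 — 3 statements merged into one kernel-verified Lean document; each statement's English description precedes it below -/
import Mathlib

section
/- Let (X₀, X₁)_X be a pair of compatible metric spaces with X₀ ∩ X₁ ≠ ∅. For every t ∈ (0, ∞), the K_M-functional K_M(t; ·, ·) is a metric on the set X₀ ∪ X₁. -/
open scoped ENNReal Classical

/-- A function `d` is a metric on the subset `A` of `X`. -/
structure IsMetricOn {X : Type*} (d : X → X → ℝ) (A : Set X) : Prop where
  refl : ∀ x ∈ A, d x x = 0
  eq_of_dist_eq_zero : ∀ x ∈ A, ∀ y ∈ A, d x y = 0 → x = y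
  symm : ∀ x ∈ A, ∀ y ∈ A, d x y = d y x
  triangle : ∀ x ∈ A, ∀ y ∈ A, ∀ z ∈ A, d x z ≤ d x y + d y z

/-- A pair of compatible metric spaces `(X₀, X₁)_X` inside an ambient metric space `X`. -/
structure CompatiblePair (X : Type*) [MetricSpace X] where
  X0 : Set X
  X1 : Set X
  d0 : X → X → ℝ
  d1 : X → X → ℝ
  inter_nonempty : (X0 ∩ X1).Nonempty
  met0 : IsMetricOn d0 X0
  met1 : IsMetricOn d1 X1
  C0 : ℝ
  C1 : ℝ
  C0_pos : 0 < C0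
  C1_pos : 0 < C1
  compat0 : ∀ x ∈ X0, ∀ y ∈ X0, dist x y ≤ C0 * d0 x y
  compat1 : ∀ x ∈ X1, ∀ y ∈ X1, dist x y ≤ C1 * d1 x y

namespace CompatiblePair

variable {X : Type*} [MetricSpace X] (P : CompatiblePair X)

/-- The `J_M` functional: `J_M(t; x, y) = max {d₀(x,y), t·d₁(x,y)}`. -/
noncomputable def JM (t : ℝ) (x y : X) : ℝ := max (P.d0 x y) (t * P.d1 x y)

/-- The cost function `h_t` on pairs in `X₀² ∪ X₁²`. -/
noncomputable def hFun (t : ℝ) (x y : X) : ℝ :=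
  if x ∈ P.X0 ∩ P.X1 ∧ y ∈ P.X0 ∩ P.X1 then min (P.d0 x y) (t * P.d1 x y)
  else if x ∈ P.X0 ∧ y ∈ P.X0 then P.d0 x y
  else t * P.d1 x y

/-- `f 0 = x, …, f n = y` is an admissible linking sequence from `x` to `y` in `X₀ ∪ X₁`. -/
def IsAdmissibleChain (x y : X) (n : ℕ) (f : ℕ → X) : Prop :=
  f 0 = x ∧ f n = y ∧ (∀ k ≤ n, f k ∈ P.X0 ∪ P.X1) ∧
    ∀ k < n, (f k ∈ P.X0 ∧ f (k + 1) ∈ P.X0) ∨ (f k ∈ P.X1 ∧ f (k + 1) ∈ P.X1)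

/-- The `K_M` functional: infimum of `∑ h_t` over admissible linking sequences. -/
noncomputable def KM (t : ℝ) (x y : X) : ℝ :=
  sInf { s : ℝ | ∃ n f, P.IsAdmissibleChain x y n f ∧
    s = ∑ k ∈ Finset.range n, P.hFun t (f k) (f (k + 1)) }

end CompatiblePair

/-- The functional `Γ_{θ,q}` of a bi-infinite real sequence, valued in `[0,∞]`. -/
noncomputable def GammaE (θ : ℝ) (q : ℝ≥0∞) (x : ℤ → ℝ) : ℝ≥0∞ :=
  if q = ∞ then ⨆ k : ℤ, ENNReal.ofReal ((2 : ℝ) ^ (-(k : ℝ) * θ) * |x k|)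
  else (∑' k : ℤ, ENNReal.ofReal ((2 : ℝ) ^ (-(k : ℝ) * θ) * |x k|) ^ q.toReal) ^ (1 / q.toReal)

/-- The real-valued functional `Γ_{θ,q}`. -/
noncomputable def Gamma (θ : ℝ) (q : ℝ≥0∞) (x : ℤ → ℝ) : ℝ := (GammaE θ q x).toReal

/-- The constant `M_{θ,q} = Γ_{θ,q}((min{1, 2^k})_k)`. -/
noncomputable def MThetaQ (θ : ℝ) (q : ℝ≥0∞) : ℝ :=
  Gamma θ q (fun k : ℤ => min 1 ((2 : ℝ) ^ k))

/-- The constant `M'_{θ,q} = (∑_j (2^{jθ} min{1,2^{-j}})^p)^{1/p}` (with `p` the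
conjugate exponent of `q`, and the supremum modification for `p = ∞`). -/
noncomputable def MConst' (θ : ℝ) (p : ℝ≥0∞) : ℝ :=
  (if p = ∞ then ⨆ j : ℤ, ENNReal.ofReal ((2 : ℝ) ^ ((j : ℝ) * θ) * min 1 ((2 : ℝ) ^ (-(j : ℝ))))
   else (∑' j : ℤ,
      ENNReal.ofReal ((2 : ℝ) ^ ((j : ℝ) * θ) * min 1 ((2 : ℝ) ^ (-(j : ℝ)))) ^ p.toReal) ^
        (1 / p.toReal)).toReal

/-- The `ℓ^q` norm of a bi-infinite real sequence, valued in `[0,∞]`. -/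
noncomputable def lqNorm (q : ℝ≥0∞) (c : ℤ → ℝ) : ℝ≥0∞ :=
  if q = ∞ then ⨆ k : ℤ, ENNReal.ofReal |c k|
  else (∑' k : ℤ, ENNReal.ofReal |c k| ^ q.toReal) ^ (1 / q.toReal)

namespace CompatiblePair

variable {X : Type*} [MetricSpace X] (P : CompatiblePair X)

/-- The metric `β_{θ,q}(x,y) = Γ_{θ,q}((K_M(2^k; x, y))_k)` on `X₀ ∩ X₁`. -/
noncomputable def beta (θ : ℝ) (q : ℝ≥0∞) (x y : X) : ℝ :=
  Gamma θ q (fun k : ℤ => P.KM ((2 : ℝ) ^ k) x y)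

/-- `u` is an approximating sequence of `x` in `(X₀ ∩ X₁, J_M(1))`: a sequence in
`X₀ ∩ X₁`, Cauchy for `J_M(1)`, with `K_M(1; uₙ, x) → 0`. -/
def IsApproxSeq (x : X) (u : ℕ → X) : Prop :=
  (∀ n, u n ∈ P.X0 ∩ P.X1) ∧
  (∀ ε > 0, ∃ N, ∀ m ≥ N, ∀ n ≥ N, P.JM 1 (u m) (u n) < ε) ∧
  Filter.Tendsto (fun n => P.KM 1 (u n) x) Filter.atTop (nhds 0)

/-- The bi-infinite linking sequence `S_k = u_k` for `k ≥ 0`, `S_k = v_{-k}` for `k < 0`. -/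
noncomputable def linkSeq (u v : ℕ → X) : ℤ → X :=
  fun k => if 0 ≤ k then u k.toNat else v (-k).toNat

/-- The functional `p_{θ,q}` valued in `[0,∞]`: infimum of
`Γ_{θ,q}((J_M(2^k; S_k, S_{k+1}))_k)` over approximating sequences of `x` and `y`. -/
noncomputable def pFunE (θ : ℝ) (q : ℝ≥0∞) (x y : X) : ℝ≥0∞ :=
  ⨅ (u : ℕ → X) (v : ℕ → X) (_ : P.IsApproxSeq x u) (_ : P.IsApproxSeq y v),
    GammaE θ q (fun k : ℤ =>
      P.JM ((2 : ℝ) ^ k) (linkSeq u v k) (linkSeq u v (k + 1)))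

/-- The real-valued functional `p_{θ,q}`. -/
noncomputable def pFun (θ : ℝ) (q : ℝ≥0∞) (x y : X) : ℝ := (P.pFunE θ q x y).toReal

/-- The symmetrization `P_{θ,q}(x,y) = (p_{θ,q}(x,y) + p_{θ,q}(y,x))/2`. -/
noncomputable def PFun (θ : ℝ) (q : ℝ≥0∞) (x y : X) : ℝ :=
  (P.pFun θ q x y + P.pFun θ q y x) / 2

/-- The metric `δ_{θ,q}`: infimum of `∑ P_{θ,q}` over finite chains in `X₀ ∩ X₁`. -/
noncomputable def delta (θ : ℝ) (q : ℝ≥0∞) (x y : X) : ℝ :=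
  sInf { s : ℝ | ∃ (n : ℕ) (f : ℕ → X), f 0 = x ∧ f n = y ∧
    (∀ k ≤ n, f k ∈ P.X0 ∩ P.X1) ∧
    s = ∑ j ∈ Finset.range n, P.PFun θ q (f j) (f (j + 1)) }

end CompatiblePair

namespace CompatiblePair

variable {X : Type*} [MetricSpace X] (P : CompatiblePair X) {t : ℝ} {x y z : X} {m n : ℕ}
  {f g : ℕ → X}

lemma hFun_comm (h : (x ∈ P.X0 ∧ y ∈ P.X0) ∨ (x ∈ P.X1 ∧ y ∈ P.X1)) :
    P.hFun t x y = P.hFun t y x := by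
  have h0 : x ∈ P.X0 → y ∈ P.X0 → P.d0 x y = P.d0 y x := fun hx hy => P.met0.symm x hx y hy
  have h1 : x ∈ P.X1 → y ∈ P.X1 → P.d1 x y = P.d1 y x := fun hx hy => P.met1.symm x hx y hy
  unfold hFun
  simp only [Set.mem_inter_iff]
  grind

/-- The ambient distance is controlled by the cost `h_t`. -/
lemma dist_le_mul_hFun (ht : 0 < t)
    (h : (x ∈ P.X0 ∧ y ∈ P.X0) ∨ (x ∈ P.X1 ∧ y ∈ P.X1)) :
    dist x y ≤ max P.C0 (P.C1 / t) * P.hFun t x y := by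
  have hC : 0 < max P.C0 (P.C1 / t) := lt_max_of_lt_left P.C0_pos
  have h0 : x ∈ P.X0 → y ∈ P.X0 → dist x y ≤ max P.C0 (P.C1 / t) * P.d0 x y := by
    intro hx hy
    have hd := P.compat0 x hx y hy
    have : 0 ≤ P.d0 x y := nonneg_of_mul_nonneg_right (dist_nonneg.trans hd) P.C0_pos
    exact hd.trans (by gcongr; exact le_max_left _ _)
  have h1 : x ∈ P.X1 → y ∈ P.X1 → dist x y ≤ max P.C0 (P.C1 / t) * (t * P.d1 x y) := by
    intro hx hy
    have hd := P.compat1 x hx y hy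
    have : 0 ≤ P.d1 x y := nonneg_of_mul_nonneg_right (dist_nonneg.trans hd) P.C1_pos
    calc dist x y ≤ P.C1 * P.d1 x y := hd
      _ = P.C1 / t * (t * P.d1 x y) := by field_simp
      _ ≤ _ := by gcongr; exact le_max_right _ _
  unfold hFun
  split_ifs with h₁ h₂
  · rw [mul_min_of_nonneg _ _ hC.le]
    exact le_min (h0 h₁.1.1 h₁.2.1) (h1 h₁.1.2 h₁.2.2)
  · exact h0 h₂.1 h₂.2
  · have h₃ := h.resolve_left h₂
    exact h1 h₃.1 h₃.2

lemma IsAdmissibleChain.dist_le_mul_sum {P : CompatiblePair X} (ht : 0 < t)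
    (hf : P.IsAdmissibleChain x y n f) :
    dist x y ≤ max P.C0 (P.C1 / t) * ∑ k ∈ Finset.range n, P.hFun t (f k) (f (k + 1)) := by
  obtain ⟨rfl, rfl, -, hl⟩ := hf
  refine (dist_le_range_sum_dist f n).trans ?_
  rw [Finset.mul_sum]
  exact Finset.sum_le_sum fun k hk => P.dist_le_mul_hFun ht (hl k (Finset.mem_range.1 hk))

lemma IsAdmissibleChain.sum_nonneg {P : CompatiblePair X} (ht : 0 < t)
    (hf : P.IsAdmissibleChain x y n f) :
    0 ≤ ∑ k ∈ Finset.range n, P.hFun t (f k) (f (k + 1)) :=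
  nonneg_of_mul_nonneg_right (dist_nonneg.trans (hf.dist_le_mul_sum ht))
    (lt_max_of_lt_left P.C0_pos)

lemma KM_le_sum (ht : 0 < t) (hf : P.IsAdmissibleChain x y n f) :
    P.KM t x y ≤ ∑ k ∈ Finset.range n, P.hFun t (f k) (f (k + 1)) :=
  csInf_le ⟨0, by rintro _ ⟨n, f, hf, rfl⟩; exact hf.sum_nonneg ht⟩ ⟨n, f, hf, rfl⟩

lemma exists_isAdmissibleChain (hx : x ∈ P.X0 ∪ P.X1) (hy : y ∈ P.X0 ∪ P.X1) :
    ∃ n f, P.IsAdmissibleChain x y n f := by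
  obtain ⟨w, hw0, hw1⟩ := P.inter_nonempty
  refine ⟨2, fun k => if k = 0 then x else if k = 1 then w else y, by simp, by simp, ?_, ?_⟩
  · intro k _
    dsimp only
    split_ifs
    exacts [hx, Or.inl hw0, hy]
  · intro k hk
    interval_cases k
    · simpa [hw0, hw1] using hx
    · simpa [hw0, hw1] using hy

lemma le_KM (hx : x ∈ P.X0 ∪ P.X1) (hy : y ∈ P.X0 ∪ P.X1) {c : ℝ}
    (h : ∀ n f, P.IsAdmissibleChain x y n f →
      c ≤ ∑ k ∈ Finset.range n, P.hFun t (f k) (f (k + 1))) :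
    c ≤ P.KM t x y := by
  obtain ⟨n, f, hf⟩ := P.exists_isAdmissibleChain hx hy
  exact le_csInf ⟨_, n, f, hf, rfl⟩ (by rintro _ ⟨n, f, hf, rfl⟩; exact h n f hf)

lemma IsAdmissibleChain.reverse {P : CompatiblePair X} (hf : P.IsAdmissibleChain x y n f) :
    P.IsAdmissibleChain y x n fun k => f (n - k) := by
  obtain ⟨h0, hn, hm, hl⟩ := hf
  refine ⟨by simpa using hn, by simpa using h0, fun k _ => hm _ (Nat.sub_le n k), fun k hk => ?_⟩
  have h := hl (n - (k + 1)) (by omega)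
  rw [show n - (k + 1) + 1 = n - k by omega] at h
  exact h.imp And.symm And.symm

lemma IsAdmissibleChain.sum_reverse {P : CompatiblePair X} (hf : P.IsAdmissibleChain x y n f) :
    ∑ k ∈ Finset.range n, P.hFun t (f (n - k)) (f (n - (k + 1))) =
      ∑ k ∈ Finset.range n, P.hFun t (f k) (f (k + 1)) := by
  rw [← Finset.sum_range_reflect (fun k => P.hFun t (f k) (f (k + 1)))]
  refine Finset.sum_congr rfl fun k hk => ?_
  have hk := Finset.mem_range.1 hk
  rw [show n - 1 - k = n - (k + 1) by omega, P.hFun_comm (hf.reverse.2.2.2 k hk),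
    show n - (k + 1) + 1 = n - k by omega]

lemma KM_le_KM_swap (ht : 0 < t) (hx : x ∈ P.X0 ∪ P.X1) (hy : y ∈ P.X0 ∪ P.X1) :
    P.KM t x y ≤ P.KM t y x :=
  P.le_KM hy hx fun _ _ hf => (P.KM_le_sum ht hf.reverse).trans_eq hf.sum_reverse

lemma IsAdmissibleChain.append {P : CompatiblePair X} (hf : P.IsAdmissibleChain x y m f)
    (hg : P.IsAdmissibleChain y z n g) :
    P.IsAdmissibleChain x z (m + n) fun k => if k < m then f k else g (k - m) := by
  obtain ⟨f0, fm, hf, lf⟩ := hf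
  obtain ⟨g0, gn, hg, lg⟩ := hg
  refine ⟨?_, by simpa using gn, fun k hk => ?_, fun k hk => ?_⟩
  · rcases Nat.eq_zero_or_pos m with rfl | hm
    · simp [g0, ← fm, f0]
    · simp [hm, f0]
  · dsimp only
    split_ifs with h
    exacts [hf k h.le, hg (k - m) (by omega)]
  · rcases lt_trichotomy (k + 1) m with h | rfl | h
    · simpa [h, Nat.lt_of_succ_lt h] using lf k (by omega)
    · simpa [g0, fm] using lf k (by omega)
    · have h' := lg (k - m) (by omega)
      rw [show k - m + 1 = k + 1 - m by omega] at h'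
      simpa [show ¬ k < m by omega, show ¬ k + 1 < m by omega] using h'

lemma IsAdmissibleChain.sum_append {P : CompatiblePair X} (hf : P.IsAdmissibleChain x y m f)
    (hg : P.IsAdmissibleChain y z n g) :
    ∑ k ∈ Finset.range (m + n), P.hFun t (if k < m then f k else g (k - m))
        (if k + 1 < m then f (k + 1) else g (k + 1 - m)) =
      ∑ k ∈ Finset.range m, P.hFun t (f k) (f (k + 1)) +
        ∑ k ∈ Finset.range n, P.hFun t (g k) (g (k + 1)) := by
  rw [Finset.sum_range_add]
  congr 1
  · refine Finset.sum_congr rfl fun k hk => ?_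
    have hk := Finset.mem_range.1 hk
    rcases (show k + 1 ≤ m from hk).lt_or_eq with h | rfl
    · simp [h, hk]
    · simp [hg.1, hf.2.1]
  · refine Finset.sum_congr rfl fun k _ => ?_
    simp [show ¬ m + k + 1 < m by omega, show m + k + 1 - m = k + 1 by omega]

lemma KM_triangle (ht : 0 < t) (hx : x ∈ P.X0 ∪ P.X1) (hy : y ∈ P.X0 ∪ P.X1)
    (hz : z ∈ P.X0 ∪ P.X1) : P.KM t x z ≤ P.KM t x y + P.KM t y z := by
  rw [← sub_le_iff_le_add]
  refine P.le_KM hx hy fun m f hf => ?_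
  rw [sub_le_comm]
  refine P.le_KM hy hz fun n g hg => ?_
  rw [sub_le_iff_le_add']
  exact (P.KM_le_sum ht (hf.append hg)).trans_eq (hf.sum_append hg)

lemma dist_le_mul_KM (ht : 0 < t) (hx : x ∈ P.X0 ∪ P.X1) (hy : y ∈ P.X0 ∪ P.X1) :
    dist x y ≤ max P.C0 (P.C1 / t) * P.KM t x y := by
  have hC : 0 < max P.C0 (P.C1 / t) := lt_max_of_lt_left P.C0_pos
  rw [← div_le_iff₀' hC]
  exact P.le_KM hx hy fun n f hf => (div_le_iff₀' hC).2 (hf.dist_le_mul_sum ht)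

lemma KM_self (ht : 0 < t) (hx : x ∈ P.X0 ∪ P.X1) : P.KM t x x = 0 := by
  refine le_antisymm ?_ (P.le_KM hx hx fun n f hf => hf.sum_nonneg ht)
  have hc : P.IsAdmissibleChain x x 0 fun _ => x := ⟨rfl, rfl, fun _ _ => hx, by simp⟩
  simpa using P.KM_le_sum ht hc

end CompatiblePair

/-- For every `t ∈ (0, ∞)`, `K_M(t; ·, ·)` is a metric on `X₀ ∪ X₁`. -/
theorem KM_isMetricOn {X : Type*} [MetricSpace X] (P : CompatiblePair X)
    (t : ℝ) (ht : 0 < t) :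
    IsMetricOn (P.KM t) (P.X0 ∪ P.X1) := by
  refine ⟨fun x hx => P.KM_self ht hx, fun x hx y hy h => ?_, fun x hx y hy => ?_,
    fun x hx y hy z hz => P.KM_triangle ht hx hy hz⟩
  · have hd := P.dist_le_mul_KM ht hx hy
    rw [h, mul_zero] at hd
    exact dist_le_zero.1 hd
  · exact le_antisymm (P.KM_le_KM_swap ht hx hy) (P.KM_le_KM_swap ht hy hx)
end

section
/- Let (X₀, X₁)_X be a pair of compatible metric spaces with X₀ ∩ X₁ ≠ ∅ and compatibility constants C₀, C₁, let θ ∈ (0, 1) and q ∈ [1, ∞]. Then for all x, y ∈ X₀ ∩ X₁, M_{θ,q} · d_X(x, y) ≤ max{C₀, C₁} · β_{θ,q}(x, y), where M_{θ,q} := Γ_{θ,q}((min{1, 2^k})_{k∈ℤ}). -/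
open scoped ENNReal Classical

/-- `Γ_{θ,q}` is monotone in the absolute values of the sequence. -/
theorem GammaE_mono (θ : ℝ) (q : ℝ≥0∞) {x y : ℤ → ℝ} (h : ∀ k, |x k| ≤ |y k|) :
    GammaE θ q x ≤ GammaE θ q y := by
  have hterm : ∀ k : ℤ, ENNReal.ofReal ((2 : ℝ) ^ (-(k : ℝ) * θ) * |x k|) ≤
      ENNReal.ofReal ((2 : ℝ) ^ (-(k : ℝ) * θ) * |y k|) := fun k =>
    ENNReal.ofReal_le_ofReal (mul_le_mul_of_nonneg_left (h k) (by positivity))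
  unfold GammaE
  split_ifs
  · exact iSup_mono hterm
  · exact ENNReal.rpow_le_rpow
      (ENNReal.tsum_le_tsum fun k => ENNReal.rpow_le_rpow (hterm k) ENNReal.toReal_nonneg)
      (by positivity)

/-- `Γ_{θ,q}` is positively homogeneous. -/
theorem GammaE_const_mul (θ : ℝ) {q : ℝ≥0∞} (hq : 1 ≤ q) {c : ℝ} (hc : 0 ≤ c) (x : ℤ → ℝ) :
    GammaE θ q (fun k => c * x k) = ENNReal.ofReal c * GammaE θ q x := by
  have hterm : ∀ k : ℤ, ENNReal.ofReal ((2 : ℝ) ^ (-(k : ℝ) * θ) * |c * x k|) =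
      ENNReal.ofReal c * ENNReal.ofReal ((2 : ℝ) ^ (-(k : ℝ) * θ) * |x k|) := fun k => by
    rw [← ENNReal.ofReal_mul hc, abs_mul, abs_of_nonneg hc, mul_left_comm]
  unfold GammaE
  simp only [hterm]
  split_ifs with hq'
  · rw [ENNReal.mul_iSup]
  · have hpos : 0 < q.toReal := ENNReal.toReal_pos (one_pos.trans_le hq).ne' hq'
    simp only [ENNReal.mul_rpow_of_nonneg _ _ hpos.le]
    rw [ENNReal.tsum_mul_left, ENNReal.mul_rpow_of_nonneg _ _ (by positivity),
      ← ENNReal.rpow_mul, mul_one_div_cancel hpos.ne', ENNReal.rpow_one]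

theorem Gamma_const_mul (θ : ℝ) {q : ℝ≥0∞} (hq : 1 ≤ q) {c : ℝ} (hc : 0 ≤ c) (x : ℤ → ℝ) :
    Gamma θ q (fun k => c * x k) = c * Gamma θ q x := by
  rw [Gamma, GammaE_const_mul θ hq hc, ENNReal.toReal_mul, ENNReal.toReal_ofReal hc, Gamma]

namespace CompatiblePair

variable {X : Type*} [MetricSpace X] (P : CompatiblePair X)

theorem d0_nonneg {x y : X} (hx : x ∈ P.X0) (hy : y ∈ P.X0) : 0 ≤ P.d0 x y :=
  nonneg_of_mul_nonneg_right (dist_nonneg.trans (P.compat0 x hx y hy)) P.C0_pos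

theorem d1_nonneg {x y : X} (hx : x ∈ P.X1) (hy : y ∈ P.X1) : 0 ≤ P.d1 x y :=
  nonneg_of_mul_nonneg_right (dist_nonneg.trans (P.compat1 x hx y hy)) P.C1_pos

theorem max_pos : 0 < max P.C0 P.C1 := lt_max_of_lt_left P.C0_pos

theorem min_mul_dist_le_d0 (t : ℝ) {x y : X} (hx : x ∈ P.X0) (hy : y ∈ P.X0) :
    min 1 t * dist x y ≤ max P.C0 P.C1 * P.d0 x y :=
  calc min 1 t * dist x y ≤ 1 * dist x y :=
        mul_le_mul_of_nonneg_right (min_le_left _ _) dist_nonneg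
    _ ≤ P.C0 * P.d0 x y := by simpa using P.compat0 x hx y hy
    _ ≤ _ := mul_le_mul_of_nonneg_right (le_max_left _ _) (P.d0_nonneg hx hy)

theorem min_mul_dist_le_d1 {t : ℝ} (ht : 0 ≤ t) {x y : X} (hx : x ∈ P.X1) (hy : y ∈ P.X1) :
    min 1 t * dist x y ≤ max P.C0 P.C1 * (t * P.d1 x y) :=
  calc min 1 t * dist x y ≤ t * dist x y :=
        mul_le_mul_of_nonneg_right (min_le_right _ _) dist_nonneg
    _ ≤ t * (max P.C0 P.C1 * P.d1 x y) := mul_le_mul_of_nonneg_left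
        ((P.compat1 x hx y hy).trans
          (mul_le_mul_of_nonneg_right (le_max_right _ _) (P.d1_nonneg hx hy))) ht
    _ = _ := mul_left_comm _ _ _

/-- The cost `h_t` of an admissible step dominates the ambient distance. -/
theorem min_mul_dist_le_hFun {t : ℝ} (ht : 0 ≤ t) {x y : X}
    (h : (x ∈ P.X0 ∧ y ∈ P.X0) ∨ (x ∈ P.X1 ∧ y ∈ P.X1)) :
    min 1 t * dist x y ≤ max P.C0 P.C1 * P.hFun t x y := by
  unfold hFun
  split_ifs with hxy h0
  · rw [mul_min_of_nonneg _ _ P.max_pos.le]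
    exact le_min (P.min_mul_dist_le_d0 t hxy.1.1 hxy.2.1)
      (P.min_mul_dist_le_d1 ht hxy.1.2 hxy.2.2)
  · exact P.min_mul_dist_le_d0 t h0.1 h0.2
  · have h1 := h.resolve_left h0
    exact P.min_mul_dist_le_d1 ht h1.1 h1.2

theorem min_mul_dist_le_sum {t : ℝ} (ht : 0 ≤ t) {x y : X} {n : ℕ} {f : ℕ → X}
    (hf : P.IsAdmissibleChain x y n f) :
    min 1 t * dist x y ≤
      max P.C0 P.C1 * ∑ k ∈ Finset.range n, P.hFun t (f k) (f (k + 1)) := by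
  obtain ⟨rfl, rfl, -, hstep⟩ := hf
  calc min 1 t * dist (f 0) (f n)
      ≤ min 1 t * ∑ k ∈ Finset.range n, dist (f k) (f (k + 1)) :=
        mul_le_mul_of_nonneg_left (dist_le_range_sum_dist f n) (le_min zero_le_one ht)
    _ ≤ _ := by
        rw [Finset.mul_sum, Finset.mul_sum]
        exact Finset.sum_le_sum fun k hk =>
          P.min_mul_dist_le_hFun ht (hstep k (Finset.mem_range.1 hk))

theorem exists_chain_hFun {x y : X} (hx : x ∈ P.X0 ∩ P.X1) (hy : y ∈ P.X0 ∩ P.X1) (t : ℝ) :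
    ∃ n f, P.IsAdmissibleChain x y n f ∧
      P.hFun t x y = ∑ k ∈ Finset.range n, P.hFun t (f k) (f (k + 1)) := by
  refine ⟨1, fun k => if k = 0 then x else y, ⟨rfl, rfl, fun k _ => ?_, fun k hk => ?_⟩, by simp⟩
  · dsimp only
    split_ifs
    exacts [Or.inl hx.1, Or.inl hy.1]
  · obtain rfl : k = 0 := by omega
    exact Or.inl ⟨hx.1, hy.1⟩

theorem min_mul_dist_le_KM {t : ℝ} (ht : 0 ≤ t) {x y : X}
    (hx : x ∈ P.X0 ∩ P.X1) (hy : y ∈ P.X0 ∩ P.X1) :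
    min 1 t * dist x y ≤ max P.C0 P.C1 * P.KM t x y := by
  rw [← div_le_iff₀' P.max_pos]
  refine le_csInf ⟨_, P.exists_chain_hFun hx hy t⟩ ?_
  rintro _ ⟨n, f, hf, rfl⟩
  rw [div_le_iff₀' P.max_pos]
  exact P.min_mul_dist_le_sum ht hf

theorem KM_nonneg {t : ℝ} (ht : 0 ≤ t) {x y : X}
    (hx : x ∈ P.X0 ∩ P.X1) (hy : y ∈ P.X0 ∩ P.X1) : 0 ≤ P.KM t x y :=
  nonneg_of_mul_nonneg_right ((mul_nonneg (le_min zero_le_one ht) dist_nonneg).trans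
    (P.min_mul_dist_le_KM ht hx hy)) P.max_pos

theorem KM_le_min {t : ℝ} (ht : 0 ≤ t) {x y : X}
    (hx : x ∈ P.X0 ∩ P.X1) (hy : y ∈ P.X0 ∩ P.X1) :
    P.KM t x y ≤ min (P.d0 x y) (t * P.d1 x y) := by
  have hle : P.KM t x y ≤ P.hFun t x y := by
    refine csInf_le ⟨min 1 t * dist x y / max P.C0 P.C1, ?_⟩ (P.exists_chain_hFun hx hy t)
    rintro _ ⟨n, f, hf, rfl⟩
    rw [div_le_iff₀' P.max_pos]
    exact P.min_mul_dist_le_sum ht hf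
  rwa [hFun, if_pos ⟨hx, hy⟩] at hle

theorem KM_le_JM_mul_min {t : ℝ} (ht : 0 ≤ t) {x y : X}
    (hx : x ∈ P.X0 ∩ P.X1) (hy : y ∈ P.X0 ∩ P.X1) :
    P.KM t x y ≤ P.JM 1 x y * min 1 t := by
  have hJ : 0 ≤ P.JM 1 x y := (P.d0_nonneg hx.1 hy.1).trans (le_max_left _ _)
  refine (P.KM_le_min ht hx hy).trans ?_
  rw [mul_min_of_nonneg _ _ hJ, mul_one, mul_comm _ t]
  refine min_le_min (le_max_left _ _) (mul_le_mul_of_nonneg_left ?_ ht)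
  exact (one_mul (P.d1 x y)).symm.le.trans (le_max_right _ _)

end CompatiblePair

/-- `M_{θ,q} · d_X(x, y) ≤ max{C₀, C₁} · β_{θ,q}(x, y)` on `X₀ ∩ X₁`. -/
theorem MThetaQ_mul_dist_le_beta {X : Type*} [MetricSpace X] (P : CompatiblePair X)
    (θ : ℝ) (hθ : θ ∈ Set.Ioo (0 : ℝ) 1) (q : ℝ≥0∞) (hq : 1 ≤ q) :
    ∀ x ∈ P.X0 ∩ P.X1, ∀ y ∈ P.X0 ∩ P.X1,
      MThetaQ θ q * dist x y ≤ max P.C0 P.C1 * P.beta θ q x y := by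
  intro x hx y hy
  have h2 : ∀ k : ℤ, (0 : ℝ) ≤ 2 ^ k := fun k => by positivity
  have hmin : ∀ k : ℤ, (0 : ℝ) ≤ min 1 (2 ^ k) := fun k => le_min zero_le_one (h2 k)
  have hC := P.max_pos.le
  by_cases htop : GammaE θ q (fun k : ℤ => min 1 ((2 : ℝ) ^ k)) = ∞
  · rw [MThetaQ, Gamma, htop, ENNReal.toReal_top, zero_mul]
    exact mul_nonneg hC ENNReal.toReal_nonneg
  have hJ : 0 ≤ P.JM 1 x y := (P.d0_nonneg hx.1 hy.1).trans (le_max_left _ _)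
  have hK : GammaE θ q (fun k : ℤ => P.KM ((2 : ℝ) ^ k) x y) ≠ ∞ := by
    refine ne_top_of_le_ne_top (ENNReal.mul_ne_top ENNReal.ofReal_ne_top htop)
      ((GammaE_mono θ q fun k => ?_).trans_eq (GammaE_const_mul θ hq hJ _))
    exact abs_le_abs_of_nonneg (P.KM_nonneg (h2 k) hx hy) (P.KM_le_JM_mul_min (h2 k) hx hy)
  rw [MThetaQ, CompatiblePair.beta, mul_comm, ← Gamma_const_mul θ hq dist_nonneg,
    ← Gamma_const_mul θ hq hC]
  refine ENNReal.toReal_mono ?_ (GammaE_mono θ q fun k => ?_)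
  · rw [GammaE_const_mul θ hq hC]
    exact ENNReal.mul_ne_top ENNReal.ofReal_ne_top hK
  · refine abs_le_abs_of_nonneg (mul_nonneg dist_nonneg (hmin k)) ?_
    rw [mul_comm]
    exact P.min_mul_dist_le_KM (h2 k) hx hy
end

section
/- Let (X₀, X₁)_X be a pair of compatible metric spaces with (X, d_X) complete, and suppose (X₀, d₀) and (X₁, d₁) are both complete. Let T: X → X be a closed operator such that T(X₀) ⊆ X₀ with T|_{X₀} Lipschitz with constant ω₀ < 1 and T(X₁) ⊆ X₁ with T|_{X₁} Lipschitz with constant ω₁ < 1. Then T has exactly one fixed point in X₀ ∪ X₁, i.e. there exists a unique x ∈ X₀ ∪ X₁ with T(x) = x. -/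
open scoped ENNReal Classical

namespace IsMetricOn

variable {X : Type*} {d : X → X → ℝ} {A : Set X}

/-- The metric space structure carried by the subtype of `A` when `d` is a metric on `A`. -/
abbrev toMetricSpace (h : IsMetricOn d A) : MetricSpace A where
  dist x y := d x y
  dist_self x := h.refl x x.2
  dist_comm x y := h.symm x x.2 y y.2
  dist_triangle x y z := h.triangle x x.2 y y.2 z z.2
  eq_of_dist_eq_zero {x y} hxy := Subtype.ext (h.eq_of_dist_eq_zero x x.2 y y.2 hxy)

/-- Banach's fixed point theorem for a subset that is complete for a metric of its own. -/
theorem exists_fixedPoint_of_contraction (h : IsMetricOn d A)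
    (hcomplete : ∀ u : ℕ → X, (∀ n, u n ∈ A) →
      (∀ ε > 0, ∃ N, ∀ m ≥ N, ∀ n ≥ N, d (u m) (u n) < ε) →
      ∃ x ∈ A, Filter.Tendsto (fun n => d (u n) x) Filter.atTop (nhds 0))
    {T : X → X} {ω : ℝ} (hω : 0 ≤ ω) (hω_lt : ω < 1) (hT : Set.MapsTo T A A)
    (hLip : ∀ x ∈ A, ∀ y ∈ A, d (T x) (T y) ≤ ω * d x y) {z : X} (hz : z ∈ A) :
    ∃ a ∈ A, T a = a ∧ (∀ y ∈ A, T y = y → y = a) ∧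
      Filter.Tendsto (fun n => d (T^[n] z) a) Filter.atTop (nhds 0) := by
  let : MetricSpace A := h.toMetricSpace
  have : CompleteSpace A := Metric.complete_of_cauchySeq_tendsto fun u hu => by
    obtain ⟨x, hx, hlim⟩ := hcomplete (fun n => u n) (fun n => (u n).2) (Metric.cauchySeq_iff.1 hu)
    exact ⟨⟨x, hx⟩, tendsto_iff_dist_tendsto_zero.2 hlim⟩
  have : Nonempty A := ⟨⟨z, hz⟩⟩
  have hcontr : ContractingWith ⟨ω, hω⟩ (hT.restrict T A A) :=
    ⟨by exact_mod_cast hω_lt, LipschitzWith.of_dist_le_mul fun x y => hLip x x.2 y y.2⟩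
  have hfix := hcontr.fixedPoint_isFixedPt
  refine ⟨hcontr.fixedPoint, hcontr.fixedPoint.2, congrArg Subtype.val hfix, ?_, ?_⟩
  · intro y hy hTy
    exact congrArg Subtype.val
      (hcontr.fixedPoint_unique (x := ⟨y, hy⟩) (Subtype.ext hTy))
  · have hlim := tendsto_iff_dist_tendsto_zero.1 (hcontr.tendsto_iterate_fixedPoint ⟨z, hz⟩)
    refine hlim.congr fun n => ?_
    change d ((hT.restrict T A A)^[n] ⟨z, hz⟩ : A) _ = _
    rw [hT.iterate_restrict n]
    rfl

end IsMetricOn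

/-- Convergence for a metric dominating the ambient one implies ambient convergence. -/
theorem tendsto_of_dist_le_mul {X : Type*} [MetricSpace X] {d : X → X → ℝ} {A : Set X} {C : ℝ}
    (hC : ∀ x ∈ A, ∀ y ∈ A, dist x y ≤ C * d x y) {u : ℕ → X} (hu : ∀ n, u n ∈ A) {a : X}
    (ha : a ∈ A) (hlim : Filter.Tendsto (fun n => d (u n) a) Filter.atTop (nhds 0)) :
    Filter.Tendsto u Filter.atTop (nhds a) :=
  tendsto_iff_dist_tendsto_zero.2 <|
    squeeze_zero (fun _ => dist_nonneg) (fun n => hC _ (hu n) _ ha)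
      (by simpa using hlim.const_mul C)

/-- fixed point corollary: if `(X, d_X)`, `(X₀, d₀)` and `(X₁, d₁)` are
complete and `T` is closed and a contraction on each of `X₀` and `X₁`, then `T` has a
unique fixed point in `X₀ ∪ X₁`. -/
theorem unique_fixed_point_in_union {X : Type*} [MetricSpace X] [CompleteSpace X]
    (P : CompatiblePair X)
    (hcomp0 : ∀ u : ℕ → X, (∀ n, u n ∈ P.X0) →
      (∀ ε > 0, ∃ N, ∀ m ≥ N, ∀ n ≥ N, P.d0 (u m) (u n) < ε) →
      ∃ x ∈ P.X0, Filter.Tendsto (fun n => P.d0 (u n) x) Filter.atTop (nhds 0))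
    (hcomp1 : ∀ u : ℕ → X, (∀ n, u n ∈ P.X1) →
      (∀ ε > 0, ∃ N, ∀ m ≥ N, ∀ n ≥ N, P.d1 (u m) (u n) < ε) →
      ∃ x ∈ P.X1, Filter.Tendsto (fun n => P.d1 (u n) x) Filter.atTop (nhds 0))
    (T : X → X)
    (hclosed : ∀ (u : ℕ → X) (x y : X),
      Filter.Tendsto u Filter.atTop (nhds x) →
      Filter.Tendsto (fun n => T (u n)) Filter.atTop (nhds y) → y = T x)
    (ω₀ ω₁ : ℝ) (hω₀ : 0 < ω₀) (hω₀' : ω₀ < 1) (hω₁ : 0 < ω₁) (hω₁' : ω₁ < 1)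
    (hT0 : ∀ x ∈ P.X0, T x ∈ P.X0)
    (hLip0 : ∀ x ∈ P.X0, ∀ y ∈ P.X0, P.d0 (T x) (T y) ≤ ω₀ * P.d0 x y)
    (hT1 : ∀ x ∈ P.X1, T x ∈ P.X1)
    (hLip1 : ∀ x ∈ P.X1, ∀ y ∈ P.X1, P.d1 (T x) (T y) ≤ ω₁ * P.d1 x y) :
    ∃! x, x ∈ P.X0 ∪ P.X1 ∧ T x = x := by
  obtain ⟨z, hz0, hz1⟩ := P.inter_nonempty
  obtain ⟨a, ha, hTa, ha_unique, ha_lim⟩ :=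
    P.met0.exists_fixedPoint_of_contraction hcomp0 hω₀.le hω₀' hT0 hLip0 hz0
  obtain ⟨b, hb, -, hb_unique, hb_lim⟩ :=
    P.met1.exists_fixedPoint_of_contraction hcomp1 hω₁.le hω₁' hT1 hLip1 hz1
  have hab : a = b := tendsto_nhds_unique
    (tendsto_of_dist_le_mul P.compat0 (fun n => Set.MapsTo.iterate hT0 n hz0) ha ha_lim)
    (tendsto_of_dist_le_mul P.compat1 (fun n => Set.MapsTo.iterate hT1 n hz1) hb hb_lim)
  subst hab
  exact ⟨a, ⟨Or.inl ha, hTa⟩, fun y ⟨hy, hTy⟩ =>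
    hy.elim (fun hy0 => ha_unique y hy0 hTy) (fun hy1 => hb_unique y hy1 hTy)⟩
end
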